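/- For every integer n ≥ 1 and every real φ > 0, (n(n+1)/2 + nφ + φ²/2)·F_n(φ) > (n − 1 + φ)·φ^{n+1}. (Equivalently, the frame sectional curvature Sec(k,t) = −(n(n+1)/2 + nφ + φ²/2)·F_n(φ)/φ^{n+1} + n − 1 + φ of the Heisenberg Kähler–Ricci soliton is strictly negative.) -/

import Mathlib

open MeasureTheory Filter Set

/-- `Fn n φ = (2·(−1)^(n+1)·(n+1)!/φ)·(∑_{k=0}^{n+1} (−1)^k φ^k/k! − e^{−φ})`. -/
noncomputable def Fn (n : ℕ) (φ : ℝ) : ℝ :=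
  2 * (-1 : ℝ) ^ (n + 1) * (Nat.factorial (n + 1)) / φ *
    ((∑ k ∈ Finset.range (n + 2), (-1 : ℝ) ^ k * φ ^ k / (Nat.factorial k)) - Real.exp (-φ))

/-- Alternating partial sums of `exp (-x)` differentiate to minus the previous partial sum. -/
theorem hasDerivAt_alternating_exp_sum (m : ℕ) (x : ℝ) :
    HasDerivAt (fun y : ℝ => ∑ k ∈ Finset.range (m + 1), (-1 : ℝ) ^ k * y ^ k / (Nat.factorial k))
      (-∑ k ∈ Finset.range m, (-1 : ℝ) ^ k * x ^ k / (Nat.factorial k)) x := by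
  induction m with
  | zero => simpa using hasDerivAt_const x (1 : ℝ)
  | succ m ih =>
    have hterm : HasDerivAt
        (fun y : ℝ => (-1 : ℝ) ^ (m + 1) * y ^ (m + 1) / (Nat.factorial (m + 1)))
        (-((-1 : ℝ) ^ m * x ^ m / (Nat.factorial m))) x := by
      refine (((hasDerivAt_pow (m + 1) x).const_mul ((-1 : ℝ) ^ (m + 1))).div_const
        (Nat.factorial (m + 1) : ℝ)).congr_deriv ?_
      have hm : (Nat.factorial m : ℝ) ≠ 0 := by positivity
      have hm' : (m : ℝ) + 1 ≠ 0 := by positivity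
      rw [Nat.factorial_succ]
      push_cast
      field_simp
      simp [pow_succ, mul_comm]
    simp only [Finset.sum_range_succ _ (m + 1)]
    refine (ih.add hterm).congr_deriv ?_
    rw [Finset.sum_range_succ]
    ring

/-- The normalized Taylor remainder of `exp (-x)`, equal to `∫ s in 0..x, (x - s) ^ m * exp (-s)`. -/
noncomputable def expNegRemainder (m : ℕ) (x : ℝ) : ℝ :=
  (-1 : ℝ) ^ m * (Nat.factorial m) *
    ((∑ k ∈ Finset.range (m + 1), (-1 : ℝ) ^ k * x ^ k / (Nat.factorial k)) - Real.exp (-x))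

theorem expNegRemainder_zero (m : ℕ) : expNegRemainder m 0 = 0 := by
  simp [expNegRemainder, Finset.sum_range_succ']

theorem hasDerivAt_expNegRemainder (m : ℕ) (x : ℝ) :
    HasDerivAt (expNegRemainder m) (x ^ m - expNegRemainder m x) x := by
  have hexp : HasDerivAt (fun y : ℝ => Real.exp (-y)) (-Real.exp (-x)) x := by
    simpa using (hasDerivAt_neg x).exp
  refine (((hasDerivAt_alternating_exp_sum m x).sub hexp).const_mul
    ((-1 : ℝ) ^ m * (Nat.factorial m))).congr_deriv ?_
  have hm : (Nat.factorial m : ℝ) ≠ 0 := by positivity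
  have hsign : (-1 : ℝ) ^ m * (-1 : ℝ) ^ m = 1 := by rw [← mul_pow]; simp
  rw [expNegRemainder, Finset.sum_range_succ]
  field_simp
  linear_combination x ^ m * hsign

/-- A rational lower bound for the normalized Taylor remainder. -/
theorem lt_expNegRemainder (n : ℕ) (hn : 1 ≤ n) (x : ℝ) (hx : 0 < x) :
    ((n : ℝ) - 1 + x) * x ^ (n + 2) / ((n : ℝ) * (n + 1) + 2 * n * x + x ^ 2) <
      expNegRemainder (n + 1) x := by
  have hn0 : (0 : ℝ) < n := by exact_mod_cast hn
  let P : ℝ → ℝ := fun y => (n : ℝ) * (n + 1) + 2 * n * y + y ^ 2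
  let G : ℝ → ℝ := fun y =>
    Real.exp y * (expNegRemainder (n + 1) y - ((n : ℝ) - 1 + y) * y ^ (n + 2) / P y)
  have hP : ∀ y, 0 ≤ y → 0 < P y := fun y hy => by positivity
  have hG : ∀ y, 0 ≤ y →
      HasDerivAt G (Real.exp y * (2 * n * (n + 1) * y ^ (n + 1) / P y ^ 2)) y := by
    intro y hy
    have hPd : HasDerivAt P (2 * n + 2 * y) y := by
      refine ((((hasDerivAt_id y).const_mul (2 * (n : ℝ))).const_add ((n : ℝ) * (n + 1))).add
        (hasDerivAt_pow 2 y)).congr_deriv ?_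
      simp
    have hQ : HasDerivAt (fun z : ℝ => ((n : ℝ) - 1 + z) * z ^ (n + 2))
        (y ^ (n + 2) + ((n : ℝ) - 1 + y) * ((n + 2) * y ^ (n + 1))) y := by
      refine (((hasDerivAt_id y).const_add ((n : ℝ) - 1)).mul
        (hasDerivAt_pow (n + 2) y)).congr_deriv ?_
      simp
    have hPy : P y ≠ 0 := (hP y hy).ne'
    refine ((Real.hasDerivAt_exp y).mul
      ((hasDerivAt_expNegRemainder (n + 1) y).sub (hQ.div hPd hPy))).congr_deriv ?_
    simp only [Pi.sub_apply, Pi.div_apply]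
    field_simp
    simp only [P]
    ring
  have hmono : StrictMonoOn G (Ici 0) := by
    apply strictMonoOn_of_deriv_pos (convex_Ici 0)
    · exact fun y hy => (hG y hy).continuousAt.continuousWithinAt
    · intro y hy
      rw [interior_Ici] at hy
      have hy : 0 < y := hy
      have := hP y hy.le
      rw [(hG y hy.le).deriv]
      positivity
  have hlt : G 0 < G x := hmono self_mem_Ici hx.le hx
  have hG0 : G 0 = 0 := by simp [G, expNegRemainder_zero]
  rw [hG0] at hlt
  exact sub_pos.mp (pos_of_mul_pos_right hlt (Real.exp_pos x).le)

/-- For every integer `n ≥ 1` and every real `φ > 0`,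
`(n(n+1)/2 + nφ + φ²/2)·Fn n φ > (n − 1 + φ)·φ^{n+1}`
(negativity of the frame sectional curvature `Sec(k,t)`). -/
theorem sec_kt_neg (n : ℕ) (hn : 1 ≤ n) (φ : ℝ) (hφ : 0 < φ) :
    ((n : ℝ) - 1 + φ) * φ ^ (n + 1) <
      ((n : ℝ) * ((n : ℝ) + 1) / 2 + (n : ℝ) * φ + φ ^ 2 / 2) * Fn n φ := by
  have hn0 : (0 : ℝ) < n := by exact_mod_cast hn
  have hlt := lt_expNegRemainder n hn φ hφ
  rw [div_lt_iff₀ (by positivity)] at hlt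
  have hF : Fn n φ = 2 * expNegRemainder (n + 1) φ / φ := by
    rw [Fn, expNegRemainder]
    ring
  rw [hF, mul_div_assoc', lt_div_iff₀ hφ]
  calc ((n : ℝ) - 1 + φ) * φ ^ (n + 1) * φ = ((n : ℝ) - 1 + φ) * φ ^ (n + 2) := by ring
    _ < _ := hlt
    _ = _ := by ring
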